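/- Let F be a γ-pliable set family on a finite set V, let I be an inclusion-minimal cover of F such that every edge of I covers some F-core, and let L be a laminar witness family for I augmented with V. Then every hollow chain (S₀, S₁, …, S_ℓ) in L has length ℓ ≤ 3. -/

import Mathlib

open scoped Classical

namespace SFEC

variable {V : Type*}

/-- An edge (an unordered pair of distinct elements) `e` covers a set `S`
if exactly one endpoint of `e` lies in `S`. -/
def Covers (e : Sym2 V) (S : Set V) : Prop :=
  ∃ u v : V, e = s(u, v) ∧ u ∈ S ∧ v ∉ S

/-- `delta I S` is the set of edges of `I` with exactly one endpoint in `S`. -/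
noncomputable def delta (I : Finset (Sym2 V)) (S : Set V) : Finset (Sym2 V) :=
  I.filter (fun e => Covers e S)

/-- `d I S = |delta I S|`. -/
noncomputable def d (I : Finset (Sym2 V)) (S : Set V) : ℕ := (delta I S).card

/-- A set family on `V`: a collection of subsets with `∅ ∉ F` and `V ∉ F`. -/
def IsSetFamily (F : Set (Set V)) : Prop := ∅ ∉ F ∧ Set.univ ∉ F

/-- `I` covers the family `F` if it covers every member of `F`. -/
def CoversFam (I : Finset (Sym2 V)) (F : Set (Set V)) : Prop := ∀ S ∈ F, 1 ≤ d I S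

/-- `I` is an inclusion-minimal cover of `F`. -/
def MinimalCover (I : Finset (Sym2 V)) (F : Set (Set V)) : Prop :=
  CoversFam I F ∧ ∀ J : Finset (Sym2 V), J ⊂ I → ¬ CoversFam J F

/-- At least two of the four statements hold. -/
def AtLeastTwo (p q r s : Prop) : Prop :=
  (p ∧ q) ∨ (p ∧ r) ∨ (p ∧ s) ∨ (q ∧ r) ∨ (q ∧ s) ∨ (r ∧ s)

/-- A family is pliable if for all `A, B ∈ F` at least two of the four sets
`A ∩ B, A ∪ B, A \ B, B \ A` belong to `F`. -/
def Pliable (F : Set (Set V)) : Prop :=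
  ∀ A ∈ F, ∀ B ∈ F, AtLeastTwo (A ∩ B ∈ F) (A ∪ B ∈ F) (A \ B ∈ F) (B \ A ∈ F)

/-- The residual family `F^I`: the members of `F` covered by no edge of `I`. -/
def Residual (F : Set (Set V)) (I : Finset (Sym2 V)) : Set (Set V) := {S ∈ F | d I S = 0}

/-- `A` and `B` cross if `A ∩ B`, `A \ B`, `B \ A` and `V \ (A ∪ B)` are all nonempty. -/
def Crosses (A B : Set V) : Prop :=
  (A ∩ B).Nonempty ∧ (A \ B).Nonempty ∧ (B \ A).Nonempty ∧ ((A ∪ B)ᶜ : Set V).Nonempty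

/-- An `F`-core: an inclusion-minimal member of `F`. -/
def Core (F : Set (Set V)) (C : Set V) : Prop := C ∈ F ∧ ∀ A ∈ F, A ⊆ C → A = C

/-- Property (γ). -/
def PropertyGamma (F : Set (Set V)) : Prop :=
  ∀ (J : Finset (Sym2 V)) (S₁ S₂ C : Set V),
    S₁ ∈ Residual F J → S₂ ∈ Residual F J → S₁ ⊂ S₂ →
    Core (Residual F J) C → Crosses C S₁ → Crosses C S₂ →
    S₂ \ (S₁ ∪ C) = ∅ ∨ S₂ \ (S₁ ∪ C) ∈ Residual F J

/-- `F` is γ-pliable: pliable and satisfying Property (γ). -/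
def GammaPliable (F : Set (Set V)) : Prop := Pliable F ∧ PropertyGamma F

/-- `S` is a witness set for the edge `e ∈ I` if `δ_I(S) = {e}`. -/
def WitnessSet (F : Set (Set V)) (I : Finset (Sym2 V)) (S : Set V) (e : Sym2 V) : Prop :=
  S ∈ F ∧ delta I S = {e}

/-- `L ⊆ F` is a witness family for `I`: `|L| = |I|` and each `e ∈ I` has a witness set in `L`. -/
def WitnessFamily (F : Set (Set V)) (I : Finset (Sym2 V)) (L : Finset (Set V)) : Prop :=
  ↑L ⊆ F ∧ L.card = I.card ∧ ∀ e ∈ I, ∃ S ∈ L, WitnessSet F I S e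

/-- A family is laminar if any two members are disjoint or one contains the other. -/
def Laminar (L : Finset (Set V)) : Prop :=
  ∀ A ∈ L, ∀ B ∈ L, A ⊆ B ∨ B ⊆ A ∨ Disjoint A B

/-- `S ∈ L` owns `C` if `S` is the inclusion-minimal member of `L` containing `C`. -/
def Owns (L : Finset (Set V)) (S C : Set V) : Prop :=
  S ∈ L ∧ C ⊆ S ∧ ∀ T ∈ L, C ⊆ T → S ⊆ T

/-- `S ∈ L` is hollow if it owns no `F`-core. -/
def Hollow (F : Set (Set V)) (L : Finset (Set V)) (S : Set V) : Prop :=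
  S ∈ L ∧ ∀ C : Set V, Core F C → ¬ Owns L S C

/-- `A` is the unique child of `S` in `L`: the unique maximal member of `L`
properly contained in `S`. -/
def UniqueChild (L : Finset (Set V)) (A S : Set V) : Prop :=
  A ∈ L ∧ A ⊂ S ∧ ∀ B ∈ L, B ⊂ S → B ⊆ A

/-- `(S 0, S 1, …, S ℓ)` is a hollow chain in `L`. -/
def HollowChain (F : Set (Set V)) (L : Finset (Set V)) (S : ℕ → Set V) (ℓ : ℕ) : Prop :=
  (∀ i ≤ ℓ, S i ∈ L) ∧
  (∀ i, 1 ≤ i → i ≤ ℓ → Hollow F L (S i)) ∧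
  S ℓ ≠ Set.univ ∧
  (∀ i, 1 ≤ i → i ≤ ℓ → UniqueChild L (S (i - 1)) (S i))

/-- `U`: the union of all `F`-cores. -/
def coreUnion (F : Set (Set V)) : Set V := ⋃₀ {C | Core F C}

/-- `F` is uncrossable. -/
def Uncrossable (F : Set (Set V)) : Prop :=
  ∀ A ∈ F, ∀ B ∈ F, (A ∩ B ∈ F ∧ A ∪ B ∈ F) ∨ (A \ B ∈ F ∧ B \ A ∈ F)

/-- `F` is semi-uncrossable. -/
def SemiUncrossable (F : Set (Set V)) : Prop :=
  ∀ A ∈ F, ∀ B ∈ F,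
    (A ∩ B ∈ F ∧ (A ∪ B ∈ F ∨ A \ B ∈ F ∨ B \ A ∈ F)) ∨ (A \ B ∈ F ∧ B \ A ∈ F)

end SFEC

open SFEC

namespace SFEC

variable {V : Type*} {F : Set (Set V)} {I : Finset (Sym2 V)} {L : Finset (Set V)}
  {A B C D : Set V} {e : Sym2 V}

theorem exists_core_subset [Finite V] (hA : A ∈ F) : ∃ C, Core F C ∧ C ⊆ A := by
  obtain ⟨C, hCA, hC⟩ := (Set.toFinite F).exists_le_minimal hA
  exact ⟨C, ⟨hC.prop, fun B hB hBC => hBC.antisymm (hC.le_of_le hB hBC)⟩, hCA⟩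

theorem Core.nonempty (hF : IsSetFamily F) (hC : Core F C) : C.Nonempty :=
  Set.nonempty_iff_ne_empty.2 fun h => hF.1 (h ▸ hC.1)

/-- A core that meets a member of a pliable family is contained in it, or the union of the two
belongs to the family. -/
theorem Core.subset_or_union_mem (hp : Pliable F) (hC : Core F C) (hA : A ∈ F)
    (h : (C ∩ A).Nonempty) : C ⊆ A ∨ C ∪ A ∈ F := by
  by_contra! hcon
  have h1 : C ∩ A ∉ F := fun hm =>
    hcon.1 (Set.inter_eq_left.1 (hC.2 _ hm Set.inter_subset_left))
  have h2 : C \ A ∉ F := fun hm => by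
    obtain ⟨x, hxC, hxA⟩ := h
    rw [← hC.2 _ hm Set.sdiff_subset] at hxC
    exact hxC.2 hxA
  rcases hp C hC.1 A hA with h | h | h | h | h | h <;> simp_all

theorem Core.eq_of_inter_nonempty (hp : Pliable F) (hC : Core F C) (hD : Core F D)
    (h : (C ∩ D).Nonempty) : C = D := by
  obtain ⟨x, hxC, hxD⟩ := h
  have h2 : C \ D ∉ F := fun hm => by
    rw [← hC.2 _ hm Set.sdiff_subset] at hxC
    exact hxC.2 hxD
  have h3 : D \ C ∉ F := fun hm => by
    rw [← hD.2 _ hm Set.sdiff_subset] at hxD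
    exact hxD.2 hxC
  have h1 : C ∩ D ∈ F := by
    rcases hp C hC.1 D hD.1 with h | h | h | h | h | h <;> simp_all
  exact (hC.2 _ h1 Set.inter_subset_left).symm.trans (hD.2 _ h1 Set.inter_subset_right)

theorem Core.crosses (hF : IsSetFamily F) (hp : Pliable F) (hC : Core F C) (hA : A ∈ F)
    (h : (C ∩ A).Nonempty) (hCA : ¬ C ⊆ A) : Crosses C A := by
  refine ⟨h, Set.sdiff_nonempty.2 hCA, Set.sdiff_nonempty.2 fun hAC => ?_, ?_⟩
  · exact hCA (hC.2 A hA hAC).ge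
  · rw [Set.nonempty_compl]
    intro hu
    exact hF.2 (hu ▸ (hC.subset_or_union_mem hp hA h).resolve_left hCA)

theorem residual_empty (F : Set (Set V)) : Residual F ∅ = F := by
  ext S
  simp [Residual, d, delta]

theorem PropertyGamma.sdiff_mem (hg : PropertyGamma F) (hA : A ∈ F) (hB : B ∈ F) (hAB : A ⊂ B)
    (hC : Core F C) (hCA : Crosses C A) (hCB : Crosses C B) :
    B \ (A ∪ C) = ∅ ∨ B \ (A ∪ C) ∈ F := by
  have := hg ∅ A B C
  simp only [residual_empty] at this
  exact this hA hB hAB hC hCA hCB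

/-- The sets of a witness family are in bijection with the edges they witness. -/
theorem WitnessFamily.exists_delta_eq (hW : WitnessFamily F I L) :
    (∀ S ∈ L, ∃ e ∈ I, delta I S = {e}) ∧ Set.InjOn (delta I) L := by
  obtain ⟨-, hcard, hw⟩ := hW
  choose! f hfL hf using hw
  have hinj : Set.InjOn f I := fun a ha b hb hab => by
    have := (hf a ha).2
    rw [hab, (hf b hb).2] at this
    exact (Finset.singleton_injective this).symm
  have himg : I.image f = L :=
    Finset.eq_of_subset_of_card_le (Finset.image_subset_iff.2 hfL)
      (by rw [Finset.card_image_of_injOn hinj, hcard])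
  subst himg
  refine ⟨fun S hS => ?_, fun S hS T hT h => ?_⟩
  · obtain ⟨e, he, rfl⟩ := Finset.mem_image.1 hS
    exact ⟨e, he, (hf e he).2⟩
  · obtain ⟨a, ha, rfl⟩ := Finset.mem_image.1 hS
    obtain ⟨b, hb, rfl⟩ := Finset.mem_image.1 hT
    rw [(hf a ha).2, (hf b hb).2] at h
    rw [Finset.singleton_injective h]

/-- For nested members `A ⊂ B ⊂ D` of a witness family, the edge witnessed by `B` joins
`B \ A` to `D \ B`. -/
theorem WitnessFamily.exists_edge (hW : WitnessFamily F I L) (hA : A ∈ L) (hB : B ∈ L)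
    (hD : D ∈ L) (hAB : A ⊂ B) (hBD : B ⊂ D) :
    ∃ u v, s(u, v) ∈ I ∧ u ∈ B \ A ∧ v ∈ D \ B := by
  obtain ⟨hex, hinj⟩ := hW.exists_delta_eq
  obtain ⟨e, heI, he⟩ := hex B hB
  have hunique : ∀ T ∈ L, Covers e T → T = B := fun T hT hc => by
    obtain ⟨e', -, he'⟩ := hex T hT
    have hmem : e ∈ delta I T := Finset.mem_filter.2 ⟨heI, hc⟩
    rw [he', Finset.mem_singleton] at hmem
    exact hinj hT hB (by rw [he, he', hmem])
  have hmem : e ∈ delta I B := by simp [he]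
  obtain ⟨-, u, v, rfl, hu, hv⟩ := Finset.mem_filter.1 hmem
  refine ⟨u, v, heI, ⟨hu, fun huA => ?_⟩, ⟨?_, hv⟩⟩
  · exact hAB.ne (hunique A hA ⟨u, v, rfl, huA, fun h => hv (hAB.subset h)⟩)
  · by_contra hvD
    exact hBD.ne (hunique D hD ⟨u, v, rfl, hBD.subset hu, hvD⟩).symm

/-- A set covered by `s(u, v)` contains exactly one of `u` and `v`. -/
theorem Covers.xor_mem {u v : V} (h : Covers s(u, v) A) : Xor (u ∈ A) (v ∈ A) := by
  obtain ⟨a, b, hab, ha, hb⟩ := h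
  rcases Sym2.eq_iff.1 hab with ⟨rfl, rfl⟩ | ⟨rfl, rfl⟩
  · exact Or.inl ⟨ha, hb⟩
  · exact Or.inr ⟨ha, hb⟩

theorem Laminar.insert_univ (hL : Laminar L) : Laminar (insert Set.univ L) := by
  intro A hA B hB
  rcases Finset.mem_insert.1 hA with rfl | hA
  · exact Or.inr (Or.inl (Set.subset_univ B))
  rcases Finset.mem_insert.1 hB with rfl | hB
  · exact Or.inl (Set.subset_univ A)
  exact hL A hA B hB

/-- A core contained in a hollow set with a unique child is contained in the child. -/
theorem Hollow.core_subset (hF : IsSetFamily F) (hL : Laminar L) (hB : Hollow F L B)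
    (hAB : UniqueChild L A B) (hC : Core F C) (hCB : C ⊆ B) : C ⊆ A := by
  have hown := hB.2 C hC
  simp only [Owns, not_and, not_forall] at hown
  obtain ⟨T, hT, hCT, hBT⟩ := hown hB.1 hCB
  rcases hL T hT B hB.1 with h | h | h
  · exact hCT.trans (hAB.2.2 T hT ⟨h, hBT⟩)
  · exact absurd h hBT
  · obtain ⟨x, hx⟩ := hC.nonempty hF
    exact absurd (hCB hx) (Set.disjoint_left.1 h (hCT hx))

/-- A core that meets the smaller of two nested members but is not contained in the larger one
contains their difference, provided that this difference contains no core. -/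
theorem Core.sdiff_subset [Finite V] (hF : IsSetFamily F) (hgp : GammaPliable F) (hA : A ∈ F)
    (hB : B ∈ F) (hAB : A ⊂ B) (hno : ∀ D, Core F D → ¬ D ⊆ B \ A) (hC : Core F C)
    (hCA : (C ∩ A).Nonempty) (hCB : ¬ C ⊆ B) : B \ A ⊆ C := by
  have hcA := hC.crosses hF hgp.1 hA hCA fun h => hCB (h.trans hAB.subset)
  have hcB := hC.crosses hF hgp.1 hB
    (hCA.mono (Set.inter_subset_inter_right C hAB.subset)) hCB
  rcases hgp.2.sdiff_mem hA hB hAB hC hcA hcB with h | h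
  · rwa [← Set.sdiff_sdiff, Set.sdiff_eq_empty] at h
  · obtain ⟨D, hD, hDs⟩ := exists_core_subset h
    exact absurd (hDs.trans (Set.sdiff_subset_sdiff_right Set.subset_union_left)) (hno D hD)

end SFEC

theorem stmt_15
    {V : Type*} [Fintype V]
    (F : Set (Set V)) (hF : IsSetFamily F) (hgp : GammaPliable F)
    (I : Finset (Sym2 V)) (hIe : ∀ e ∈ I, ¬ e.IsDiag)
    (hmin : MinimalCover I F)
    (hcov : ∀ e ∈ I, ∃ C : Set V, Core F C ∧ Covers e C)
    (L : Finset (Set V)) (hWF : WitnessFamily F I L) (hlam : Laminar L)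
    (S : ℕ → Set V) (ℓ : ℕ)
    (hchain : HollowChain F (insert Set.univ L) S ℓ) :
    ℓ ≤ 3 := by
  obtain ⟨hmem, hhol, hne, hchild⟩ := hchain
  by_contra! hl
  have hss : ∀ i < ℓ, S i ⊂ S (i + 1) := fun i hi => (hchild (i + 1) (by omega) hi).2.1
  have hL : ∀ i ≤ ℓ, S i ∈ L := fun i hi => by
    refine (Finset.mem_insert.1 (hmem i hi)).resolve_left fun hu => ?_
    rcases hi.eq_or_lt with rfl | hi
    · exact hne hu
    · exact (hss i hi).2 (hu ▸ Set.subset_univ _)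
  have hSF : ∀ i ≤ ℓ, S i ∈ F := fun i hi => hWF.1 (hL i hi)
  have hcore : ∀ C, Core F C → ∀ i ≤ ℓ, C ⊆ S i → C ⊆ S 0 := by
    intro C hC i
    induction i with
    | zero => exact fun _ h => h
    | succ i ih =>
      exact fun hi h => ih (by omega) <|
        (hhol (i + 1) (by omega) hi).core_subset hF hlam.insert_univ
          (hchild (i + 1) (by omega) hi) hC h
  have h01 := (hss 0 (by omega)).subset
  have h12 := (hss 1 (by omega)).subset
  have h23 := hss 2 (by omega)
  have h34 := hss 3 (by omega)
  obtain ⟨u, v, he, hu, hv⟩ := hWF.exists_edge (hL 0 (by omega)) (hL 1 (by omega))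
    (hL 2 (by omega)) (hss 0 (by omega)) (hss 1 (by omega))
  obtain ⟨C, hC, hCe⟩ := hcov _ he
  obtain ⟨x, hxC, hx2, hx0⟩ : ∃ x ∈ C, x ∈ S 2 ∧ x ∉ S 0 := by
    rcases hCe.xor_mem with h | h
    · exact ⟨u, h.1, h12 hu.1, hu.2⟩
    · exact ⟨v, h.1, hv.1, fun h => hv.2 (h01 h)⟩
  have hsub : S 4 \ S 2 ⊆ C := by
    refine hC.sdiff_subset hF hgp (hSF 2 (by omega)) (hSF 4 (by omega)) (h23.trans h34) ?_
      ⟨x, hxC, hx2⟩ fun h => hx0 (hcore C hC 4 (by omega) h hxC)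
    intro D hD hDs
    obtain ⟨y, hy⟩ := hD.nonempty hF
    exact (hDs hy).2 (h12 (h01 (hcore D hD 4 (by omega) (fun z hz => (hDs hz).1) hy)))
  obtain ⟨a, b, he', ha, hb⟩ := hWF.exists_edge (hL 2 (by omega)) (hL 3 (by omega))
    (hL 4 (by omega)) h23 h34
  have haC : a ∈ C := hsub ⟨h34.subset ha.1, ha.2⟩
  have hbC : b ∈ C := hsub ⟨hb.1, fun h => hb.2 (h23.subset h)⟩
  obtain ⟨D, hD, hDe⟩ := hcov _ he'
  have hCD : C = D := by
    rcases hDe.xor_mem with h | h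
    · exact hC.eq_of_inter_nonempty hgp.1 hD ⟨a, haC, h.1⟩
    · exact hC.eq_of_inter_nonempty hgp.1 hD ⟨b, hbC, h.1⟩
  subst hCD
  rcases hDe.xor_mem with h | h
  · exact h.2 hbC
  · exact h.2 haC
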